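/- arXiv:1505.06267 — 10 statements merged into one kernel-verified Lean document; each statement's English description precedes it below -/
import Mathlib

section
/- Let t ∈ ℂ, t ≠ 0, λ = −t², and let V : ℝ → ℂ be continuous. Let μ₁, μ₂ : ℝ → ℂ be twice continuously differentiable solutions of μ'' + (λ − V(x))μ = 0 on ℝ, and assume that for every x ∈ ℝ the function y ↦ e^{−ty}V(y)μᵢ(y) is integrable on [x,∞) and y ↦ e^{ty}V(y)μᵢ(y) is integrable on (−∞,x] (i = 1,2). Then each function x ↦ D(x,λ,μᵢ) is twice continuously differentiable and satisfies D''(x,λ,μᵢ) = −λ·D(x,λ,μᵢ); consequently the function x ↦ D(x,λ,μ₁)·D'(x,λ,μ₂) − D'(x,λ,μ₁)·D(x,λ,μ₂) is constant on ℝ. -/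
open MeasureTheory Set Filter

/-- `D t V μ x = μ(x) + (1/(2t)) ∫_x^∞ e^{-t(y-x)} V(y) μ(y) dy
    + (1/(2t)) ∫_{-∞}^x e^{t(y-x)} V(y) μ(y) dy`, where `t = √(-λ)`. -/
noncomputable def D (t : ℂ) (V μ : ℝ → ℂ) (x : ℝ) : ℂ :=
  μ x + (1 / (2 * t)) * (∫ y in Ici x, Complex.exp (-t * ((y : ℂ) - (x : ℂ))) * V y * μ y)
      + (1 / (2 * t)) * (∫ y in Iic x, Complex.exp (t * ((y : ℂ) - (x : ℂ))) * V y * μ y)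

theorem hasDerivAt_integral_Iic {f : ℝ → ℂ} (hf : Continuous f)
    (hint : ∀ x, IntegrableOn f (Iic x)) (x : ℝ) :
    HasDerivAt (fun x => ∫ y in Iic x, f y) (f x) x := by
  have h : (fun x => ∫ y in Iic x, f y) = fun x =>
      (∫ y in (0 : ℝ)..x, f y) + ∫ y in Iic 0, f y := by
    funext x
    rw [← intervalIntegral.integral_Iic_sub_Iic (hint 0) (hint x), sub_add_cancel]
  rw [h]
  exact (hf.integral_hasStrictDerivAt 0 x).hasDerivAt.add_const _

theorem hasDerivAt_integral_Ici {f : ℝ → ℂ} (hf : Continuous f)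
    (hint : ∀ x, IntegrableOn f (Ici x)) (x : ℝ) :
    HasDerivAt (fun x => ∫ y in Ici x, f y) (-f x) x := by
  have h : (fun x => ∫ y in Ici x, f y) = fun x =>
      (∫ y in Ici 0, f y) - ∫ y in (0 : ℝ)..x, f y := by
    funext x
    rw [← intervalIntegral.integral_Ici_sub_Ici' (hint 0) (hint x), sub_sub_cancel]
  rw [h]
  exact (hf.integral_hasStrictDerivAt 0 x).hasDerivAt.const_sub _

theorem D_eq (t : ℂ) (V μ : ℝ → ℂ) (x : ℝ) :
    D t V μ x = μ x
      + 1 / (2 * t) * (Complex.exp (t * x) * ∫ y : ℝ in Ici x, Complex.exp (-t * y) * V y * μ y)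
      + 1 / (2 * t) *
        (Complex.exp (-t * x) * ∫ y : ℝ in Iic x, Complex.exp (t * y) * V y * μ y) := by
  unfold D
  have h₁ (y : ℝ) : Complex.exp (-t * ((y : ℂ) - x)) * V y * μ y
      = Complex.exp (t * x) * (Complex.exp (-t * y) * V y * μ y) := by
    rw [show -t * ((y : ℂ) - x) = t * x + -t * y by ring, Complex.exp_add]; ring
  have h₂ (y : ℝ) : Complex.exp (t * ((y : ℂ) - x)) * V y * μ y
      = Complex.exp (-t * x) * (Complex.exp (t * y) * V y * μ y) := by
    rw [show t * ((y : ℂ) - x) = -t * x + t * y by ring, Complex.exp_add]; ring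
  simp only [h₁, h₂, integral_const_mul]

theorem hasDerivAt_cexp_mul_ofReal (a : ℂ) (x : ℝ) :
    HasDerivAt (fun x : ℝ => Complex.exp (a * x)) (Complex.exp (a * x) * a) x := by
  simpa using (((hasDerivAt_id x).ofReal_comp).const_mul a).cexp

theorem exists_hasDerivAt_D {t : ℂ} (ht : t ≠ 0) {V μ : ℝ → ℂ} (hV : Continuous V)
    (hμ : ContDiff ℝ 2 μ) (hode : ∀ x : ℝ, deriv (deriv μ) x + (-t ^ 2 - V x) * μ x = 0)
    (hp : ∀ x : ℝ, IntegrableOn (fun y : ℝ => Complex.exp (-t * y) * V y * μ y) (Ici x))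
    (hm : ∀ x : ℝ, IntegrableOn (fun y : ℝ => Complex.exp (t * y) * V y * μ y) (Iic x)) :
    ∃ D' : ℝ → ℂ, ∀ x, HasDerivAt (D t V μ) (D' x) x ∧ HasDerivAt D' (t ^ 2 * D t V μ x) x := by
  have hμc := hμ.continuous
  have hμ1 (x : ℝ) : HasDerivAt μ (deriv μ x) x :=
    (hμ.differentiable (by norm_num) x).hasDerivAt
  have hμ2 (x : ℝ) : HasDerivAt (deriv μ) (deriv (deriv μ) x) x :=
    ((hμ.iterate_deriv' 1 1).differentiable (by norm_num) x).hasDerivAt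
  set P : ℝ → ℂ := fun x => ∫ y : ℝ in Ici x, Complex.exp (-t * y) * V y * μ y
  set M : ℝ → ℂ := fun x => ∫ y : ℝ in Iic x, Complex.exp (t * y) * V y * μ y
  have hD : D t V μ = fun x : ℝ => μ x + 1 / (2 * t) * (Complex.exp (t * x) * P x)
      + 1 / (2 * t) * (Complex.exp (-t * x) * M x) := funext (D_eq t V μ)
  have hP (x : ℝ) : HasDerivAt P (-(Complex.exp (-t * x) * V x * μ x)) x :=
    hasDerivAt_integral_Ici (f := fun y : ℝ => Complex.exp (-t * y) * V y * μ y)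
      (by fun_prop) hp x
  have hM (x : ℝ) : HasDerivAt M (Complex.exp (t * x) * V x * μ x) x :=
    hasDerivAt_integral_Iic (f := fun y : ℝ => Complex.exp (t * y) * V y * μ y)
      (by fun_prop) hm x
  have hexp (x : ℝ) : Complex.exp (t * x) * Complex.exp (-t * x) = 1 := by
    rw [← Complex.exp_add]; simp
  have hEP (x : ℝ) : HasDerivAt (fun x : ℝ => Complex.exp (t * x) * P x)
      (t * (Complex.exp (t * x) * P x) - V x * μ x) x := by
    convert! (hasDerivAt_cexp_mul_ofReal t x).mul (hP x) using 1
    linear_combination (V x * μ x) * hexp x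
  have hEM (x : ℝ) : HasDerivAt (fun x : ℝ => Complex.exp (-t * x) * M x)
      (-t * (Complex.exp (-t * x) * M x) + V x * μ x) x := by
    convert! (hasDerivAt_cexp_mul_ofReal (-t) x).mul (hM x) using 1
    linear_combination -(V x * μ x) * hexp x
  refine ⟨fun x => deriv μ x + 1 / 2 * (Complex.exp (t * x) * P x)
    - 1 / 2 * (Complex.exp (-t * x) * M x), fun x => ⟨?_, ?_⟩⟩
  · rw [hD]
    convert! ((hμ1 x).add ((hEP x).const_mul (1 / (2 * t)))).add
      ((hEM x).const_mul (1 / (2 * t))) using 1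
    field_simp
    ring
  · rw [hD]
    convert! ((hμ2 x).add ((hEP x).const_mul (1 / 2))).sub ((hEM x).const_mul (1 / 2)) using 1
    rw [eq_sub_of_add_eq (hode x)]
    field_simp
    ring

theorem contDiff_two_of_hasDerivAt {f f' f'' : ℝ → ℂ} (hf : ∀ x, HasDerivAt f (f' x) x)
    (hf' : ∀ x, HasDerivAt f' (f'' x) x) (hc : Continuous f'') : ContDiff ℝ 2 f := by
  have h : deriv f = f' := funext fun x => (hf x).deriv
  have h' : deriv f' = f'' := funext fun x => (hf' x).deriv
  rw [show (2 : WithTop ℕ∞) = 1 + 1 by norm_num, contDiff_succ_iff_deriv, h,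
    contDiff_one_iff_deriv, h']
  exact ⟨fun x => (hf x).differentiableAt, by simp, fun x => (hf' x).differentiableAt, hc⟩

theorem wronskian_eq {f f' g g' : ℝ → ℂ} {c : ℂ} (hf : ∀ x, HasDerivAt f (f' x) x)
    (hf' : ∀ x, HasDerivAt f' (c * f x) x) (hg : ∀ x, HasDerivAt g (g' x) x)
    (hg' : ∀ x, HasDerivAt g' (c * g x) x) (x y : ℝ) :
    f x * g' x - f' x * g x = f y * g' y - f' y * g y := by
  have h (x : ℝ) : HasDerivAt (fun x => f x * g' x - f' x * g x) 0 x := by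
    convert! ((hf x).mul (hg' x)).sub ((hf' x).mul (hg x)) using 1
    ring
  exact is_const_of_deriv_eq_zero (fun x => (h x).differentiableAt) (fun x => (h x).deriv) x y

/-- If `μ₁, μ₂` are C² solutions of `μ'' + (λ - V)μ = 0` (with `λ = -t²`,
`t ≠ 0`, `V` continuous) satisfying the integrability conditions making `D` well defined,
then each `x ↦ D(x,λ,μᵢ)` is twice continuously differentiable with `D'' = -λ D`, and the
Wronskian-type expression `D(·,μ₁) D'(·,μ₂) - D'(·,μ₁) D(·,μ₂)` is constant on `ℝ`. -/
theorem statement3 (t : ℂ) (ht : t ≠ 0) (lam : ℂ) (hlam : lam = -t ^ 2)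
    (V : ℝ → ℂ) (hV : Continuous V)
    (μ₁ μ₂ : ℝ → ℂ) (hμ₁ : ContDiff ℝ 2 μ₁) (hμ₂ : ContDiff ℝ 2 μ₂)
    (hode₁ : ∀ x : ℝ, deriv (deriv μ₁) x + (lam - V x) * μ₁ x = 0)
    (hode₂ : ∀ x : ℝ, deriv (deriv μ₂) x + (lam - V x) * μ₂ x = 0)
    (hint₁p : ∀ x : ℝ, IntegrableOn (fun y : ℝ => Complex.exp (-t * y) * V y * μ₁ y) (Ici x))
    (hint₁m : ∀ x : ℝ, IntegrableOn (fun y : ℝ => Complex.exp (t * y) * V y * μ₁ y) (Iic x))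
    (hint₂p : ∀ x : ℝ, IntegrableOn (fun y : ℝ => Complex.exp (-t * y) * V y * μ₂ y) (Ici x))
    (hint₂m : ∀ x : ℝ, IntegrableOn (fun y : ℝ => Complex.exp (t * y) * V y * μ₂ y) (Iic x)) :
    (ContDiff ℝ 2 (D t V μ₁) ∧ ContDiff ℝ 2 (D t V μ₂)) ∧
    (∀ x : ℝ, deriv (deriv (D t V μ₁)) x = -lam * D t V μ₁ x) ∧
    (∀ x : ℝ, deriv (deriv (D t V μ₂)) x = -lam * D t V μ₂ x) ∧
    (∀ x₁ x₂ : ℝ,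
      D t V μ₁ x₁ * deriv (D t V μ₂) x₁ - deriv (D t V μ₁) x₁ * D t V μ₂ x₁ =
      D t V μ₁ x₂ * deriv (D t V μ₂) x₂ - deriv (D t V μ₁) x₂ * D t V μ₂ x₂) := by
  subst hlam
  obtain ⟨D₁, h₁⟩ := exists_hasDerivAt_D ht hV hμ₁ hode₁ hint₁p hint₁m
  obtain ⟨D₂, h₂⟩ := exists_hasDerivAt_D ht hV hμ₂ hode₂ hint₂p hint₂m
  have hc₁ : Continuous (D t V μ₁) :=
    continuous_iff_continuousAt.2 fun x => (h₁ x).1.continuousAt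
  have hc₂ : Continuous (D t V μ₂) :=
    continuous_iff_continuousAt.2 fun x => (h₂ x).1.continuousAt
  have hd₁ : deriv (D t V μ₁) = D₁ := funext fun x => (h₁ x).1.deriv
  have hd₂ : deriv (D t V μ₂) = D₂ := funext fun x => (h₂ x).1.deriv
  rw [hd₁, hd₂, neg_neg]
  exact ⟨⟨contDiff_two_of_hasDerivAt (fun x => (h₁ x).1) (fun x => (h₁ x).2) (hc₁.const_mul _),
      contDiff_two_of_hasDerivAt (fun x => (h₂ x).1) (fun x => (h₂ x).2) (hc₂.const_mul _)⟩,
    fun x => (h₁ x).2.deriv, fun x => (h₂ x).2.deriv,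
    wronskian_eq (fun x => (h₁ x).1) (fun x => (h₁ x).2) (fun x => (h₂ x).1) (fun x => (h₂ x).2)⟩
end

section
/- Let t ∈ ℂ, t ≠ 0, λ = −t², and let V : ℝ → ℂ be continuous. Let ν₁, ν₂, μ₁, μ₂ : ℝ → ℂ be twice continuously differentiable solutions of μ'' + (λ − V(x))μ = 0 on ℝ with ν₁(0) = 1, ν₁'(0) = 0, ν₂(0) = 0, ν₂'(0) = 1, and assume that for each of these four functions and every x ∈ ℝ the product of the function with e^{−ty}V(y) is integrable on [x,∞) and with e^{ty}V(y) is integrable on (−∞,x]. Then 𝔻(λ, μ₁, μ₂) = (μ₁(0)μ₂'(0) − μ₁'(0)μ₂(0)) · 𝔻(λ, ν₁, ν₂). -/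
open MeasureTheory Set Filter

/-- `𝔻(λ, μ₁, μ₂) = D(0,λ,μ₁) D'(0,λ,μ₂) - D'(0,λ,μ₁) D(0,λ,μ₂)`. -/
noncomputable def DD (t : ℂ) (V μ₁ μ₂ : ℝ → ℂ) : ℂ :=
  D t V μ₁ 0 * deriv (D t V μ₂) 0 - deriv (D t V μ₁) 0 * D t V μ₂ 0

/-- The Wronskian of two solutions of the same equation `u'' = q u` is constant. -/
theorem wronskian_eq_of_deriv_deriv_eq_mul {q f g : ℝ → ℂ} (hf : ContDiff ℝ 2 f)
    (hg : ContDiff ℝ 2 g) (hf' : ∀ x, deriv (deriv f) x = q x * f x)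
    (hg' : ∀ x, deriv (deriv g) x = q x * g x) (x y : ℝ) :
    f x * deriv g x - deriv f x * g x = f y * deriv g y - deriv f y * g y := by
  have key : ∀ {u : ℝ → ℂ}, ContDiff ℝ 2 u → (∀ x, deriv (deriv u) x = q x * u x) →
      ∀ x, HasDerivAt u (deriv u x) x ∧ HasDerivAt (deriv u) (q x * u x) x := by
    intro u hu hu' x
    have h1 : ContDiff ℝ 1 (deriv u) :=
      ContDiff.deriv' (n := 1) (by simpa [one_add_one_eq_two] using hu)
    refine ⟨(hu.differentiable (by simp) x).hasDerivAt, ?_⟩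
    rw [← hu' x]
    exact (h1.differentiable (by simp) x).hasDerivAt
  have hW : ∀ x, HasDerivAt (fun x => f x * deriv g x - deriv f x * g x) 0 x := by
    intro x
    obtain ⟨f1, f2⟩ := key hf hf' x
    obtain ⟨g1, g2⟩ := key hg hg' x
    exact ((f1.mul g2).sub (f2.mul g1)).congr_deriv (by ring)
  exact is_const_of_deriv_eq_zero (fun x => (hW x).differentiableAt) (fun x => (hW x).deriv) x y

/-- A solution of `u'' = q u` is a combination of the two normalized solutions. -/
theorem eq_combination_of_normalized_solutions {q n₁ n₂ u : ℝ → ℂ} (hn₁ : ContDiff ℝ 2 n₁)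
    (hn₂ : ContDiff ℝ 2 n₂) (hu : ContDiff ℝ 2 u)
    (h₁ : ∀ x, deriv (deriv n₁) x = q x * n₁ x) (h₂ : ∀ x, deriv (deriv n₂) x = q x * n₂ x)
    (h : ∀ x, deriv (deriv u) x = q x * u x)
    (i₁ : n₁ 0 = 1 ∧ deriv n₁ 0 = 0) (i₂ : n₂ 0 = 0 ∧ deriv n₂ 0 = 1) :
    u = fun x => u 0 * n₁ x + deriv u 0 * n₂ x := by
  funext x
  have e₁₂ := wronskian_eq_of_deriv_deriv_eq_mul hn₁ hn₂ h₁ h₂ x 0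
  have e₁ := wronskian_eq_of_deriv_deriv_eq_mul hu hn₁ h h₁ x 0
  have e₂ := wronskian_eq_of_deriv_deriv_eq_mul hu hn₂ h h₂ x 0
  simp only [i₁, i₂] at e₁₂ e₁ e₂
  linear_combination (-u x) * e₁₂ + n₁ x * e₂ - n₂ x * e₁

theorem D_eq_exp_mul (t : ℂ) (V μ : ℝ → ℂ) (x : ℝ) :
    D t V μ x = μ x
      + (1 / (2 * t)) * (Complex.exp (t * x) * ∫ y in Ici x, Complex.exp (-t * y) * V y * μ y)
      + (1 / (2 * t)) * (Complex.exp (-t * x) * ∫ y in Iic x, Complex.exp (t * y) * V y * μ y) := by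
  simp only [D, ← integral_const_mul]
  congr 4 <;> funext y
  · rw [show -t * ((y : ℂ) - x) = t * x + -t * y by ring, Complex.exp_add]
    ring
  · rw [show t * ((y : ℂ) - x) = -t * x + t * y by ring, Complex.exp_add]
    ring

theorem differentiable_integral_Iic {f : ℝ → ℂ} (hf : Continuous f)
    (hi : ∀ x, IntegrableOn f (Iic x)) : Differentiable ℝ fun x => ∫ y in Iic x, f y := by
  have h : (fun x => ∫ y in Iic x, f y) = fun x => (∫ y in (0 : ℝ)..x, f y) + ∫ y in Iic 0, f y := by
    funext x
    rw [← intervalIntegral.integral_Iic_sub_Iic (hi 0) (hi x), sub_add_cancel]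
  rw [h]
  exact fun x => ((hf.integral_hasStrictDerivAt 0 x).hasDerivAt.differentiableAt).add_const _

theorem differentiable_integral_Ici {f : ℝ → ℂ} (hf : Continuous f)
    (hi : ∀ x, IntegrableOn f (Ici x)) : Differentiable ℝ fun x => ∫ y in Ici x, f y := by
  have h : (fun x => ∫ y in Ici x, f y) = fun x => (∫ y in Ici 0, f y) - ∫ y in (0 : ℝ)..x, f y := by
    funext x
    rw [eq_sub_iff_add_eq', integral_Ici_eq_integral_Ioi, integral_Ici_eq_integral_Ioi]
    exact intervalIntegral.integral_interval_add_Ioi ((hi 0).mono_set Ioi_subset_Ici_self)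
      ((hi x).mono_set Ioi_subset_Ici_self)
  rw [h]
  exact fun x => ((hf.integral_hasStrictDerivAt 0 x).hasDerivAt.differentiableAt).const_sub _

theorem differentiable_D {t : ℂ} {V μ : ℝ → ℂ} (hV : Continuous V) (hμ : Differentiable ℝ μ)
    (hp : ∀ x : ℝ, IntegrableOn (fun y : ℝ => Complex.exp (-t * y) * V y * μ y) (Ici x))
    (hm : ∀ x : ℝ, IntegrableOn (fun y : ℝ => Complex.exp (t * y) * V y * μ y) (Iic x)) :
    Differentiable ℝ (D t V μ) := by
  have hexp : ∀ s : ℂ, Differentiable ℝ fun x : ℝ => Complex.exp (s * x) := fun s x =>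
    (((Complex.ofRealCLM.hasDerivAt (x := x)).const_mul s).cexp).differentiableAt
  have hc : ∀ s : ℂ, Continuous fun y : ℝ => Complex.exp (s * y) * V y * μ y := fun s =>
    ((hexp s).continuous.mul hV).mul hμ.continuous
  rw [funext (D_eq_exp_mul t V μ)]
  exact (hμ.add (((hexp t).mul (differentiable_integral_Ici (hc _) hp)).const_mul _)).add
    (((hexp (-t)).mul (differentiable_integral_Iic (hc _) hm)).const_mul _)

theorem D_combination {t : ℂ} {V n₁ n₂ : ℝ → ℂ}
    (hp₁ : ∀ x : ℝ, IntegrableOn (fun y : ℝ => Complex.exp (-t * y) * V y * n₁ y) (Ici x))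
    (hm₁ : ∀ x : ℝ, IntegrableOn (fun y : ℝ => Complex.exp (t * y) * V y * n₁ y) (Iic x))
    (hp₂ : ∀ x : ℝ, IntegrableOn (fun y : ℝ => Complex.exp (-t * y) * V y * n₂ y) (Ici x))
    (hm₂ : ∀ x : ℝ, IntegrableOn (fun y : ℝ => Complex.exp (t * y) * V y * n₂ y) (Iic x))
    (a b : ℂ) :
    D t V (fun x => a * n₁ x + b * n₂ x) = fun x => a * D t V n₁ x + b * D t V n₂ x := by
  have hint : ∀ {w : ℝ → ℂ} {s : Set ℝ}, IntegrableOn (fun y => w y * n₁ y) s →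
      IntegrableOn (fun y => w y * n₂ y) s →
      ∫ y in s, w y * (a * n₁ y + b * n₂ y) =
        a * (∫ y in s, w y * n₁ y) + b * ∫ y in s, w y * n₂ y := by
    intro w s h₁ h₂
    rw [← integral_const_mul, ← integral_const_mul,
      ← integral_add (h₁.const_mul a) (h₂.const_mul b)]
    congr 1
    funext y
    ring
  funext x
  simp only [D_eq_exp_mul]
  rw [hint (hp₁ x) (hp₂ x), hint (hm₁ x) (hm₂ x)]
  ring

/-- For C² solutions `ν₁, ν₂, μ₁, μ₂` of `μ'' + (λ - V)μ = 0` (with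
`λ = -t²`, `t ≠ 0`, `V` continuous), where `ν₁, ν₂` satisfy the standard initial
conditions at `0`, and all four functions satisfy the integrability conditions making `D`
well defined, one has `𝔻(λ,μ₁,μ₂) = (μ₁(0)μ₂'(0) - μ₁'(0)μ₂(0)) · 𝔻(λ,ν₁,ν₂)`. -/
theorem statement4 (t : ℂ) (ht : t ≠ 0) (lam : ℂ) (hlam : lam = -t ^ 2)
    (V : ℝ → ℂ) (hV : Continuous V)
    (ν₁ ν₂ μ₁ μ₂ : ℝ → ℂ)
    (hν₁ : ContDiff ℝ 2 ν₁) (hν₂ : ContDiff ℝ 2 ν₂)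
    (hμ₁ : ContDiff ℝ 2 μ₁) (hμ₂ : ContDiff ℝ 2 μ₂)
    (hodeν₁ : ∀ x : ℝ, deriv (deriv ν₁) x + (lam - V x) * ν₁ x = 0)
    (hodeν₂ : ∀ x : ℝ, deriv (deriv ν₂) x + (lam - V x) * ν₂ x = 0)
    (hodeμ₁ : ∀ x : ℝ, deriv (deriv μ₁) x + (lam - V x) * μ₁ x = 0)
    (hodeμ₂ : ∀ x : ℝ, deriv (deriv μ₂) x + (lam - V x) * μ₂ x = 0)
    (hinit₁ : ν₁ 0 = 1 ∧ deriv ν₁ 0 = 0) (hinit₂ : ν₂ 0 = 0 ∧ deriv ν₂ 0 = 1)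
    (hintν₁p : ∀ x : ℝ, IntegrableOn (fun y : ℝ => Complex.exp (-t * y) * V y * ν₁ y) (Ici x))
    (hintν₁m : ∀ x : ℝ, IntegrableOn (fun y : ℝ => Complex.exp (t * y) * V y * ν₁ y) (Iic x))
    (hintν₂p : ∀ x : ℝ, IntegrableOn (fun y : ℝ => Complex.exp (-t * y) * V y * ν₂ y) (Ici x))
    (hintν₂m : ∀ x : ℝ, IntegrableOn (fun y : ℝ => Complex.exp (t * y) * V y * ν₂ y) (Iic x))
    (hintμ₁p : ∀ x : ℝ, IntegrableOn (fun y : ℝ => Complex.exp (-t * y) * V y * μ₁ y) (Ici x))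
    (hintμ₁m : ∀ x : ℝ, IntegrableOn (fun y : ℝ => Complex.exp (t * y) * V y * μ₁ y) (Iic x))
    (hintμ₂p : ∀ x : ℝ, IntegrableOn (fun y : ℝ => Complex.exp (-t * y) * V y * μ₂ y) (Ici x))
    (hintμ₂m : ∀ x : ℝ, IntegrableOn (fun y : ℝ => Complex.exp (t * y) * V y * μ₂ y) (Iic x)) :
    DD t V μ₁ μ₂ = (μ₁ 0 * deriv μ₂ 0 - deriv μ₁ 0 * μ₂ 0) * DD t V ν₁ ν₂ := by
  have hq : ∀ {u : ℝ → ℂ}, (∀ x : ℝ, deriv (deriv u) x + (lam - V x) * u x = 0) →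
      ∀ x, deriv (deriv u) x = (V x - lam) * u x := fun h x => by linear_combination h x
  have hd₁ := differentiable_D hV (hν₁.differentiable (by simp)) hintν₁p hintν₁m
  have hd₂ := differentiable_D hV (hν₂.differentiable (by simp)) hintν₂p hintν₂m
  have hD : ∀ {u : ℝ → ℂ}, ContDiff ℝ 2 u →
      (∀ x : ℝ, deriv (deriv u) x + (lam - V x) * u x = 0) →
      D t V u 0 = u 0 * D t V ν₁ 0 + deriv u 0 * D t V ν₂ 0 ∧
      deriv (D t V u) 0 = u 0 * deriv (D t V ν₁) 0 + deriv u 0 * deriv (D t V ν₂) 0 := by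
    intro u hu hode
    have hDu : D t V u = fun x => u 0 * D t V ν₁ x + deriv u 0 * D t V ν₂ x :=
      (congrArg (D t V) (eq_combination_of_normalized_solutions hν₁ hν₂ hu (hq hodeν₁)
        (hq hodeν₂) (hq hode) hinit₁ hinit₂)).trans
        (D_combination hintν₁p hintν₁m hintν₂p hintν₂m _ _)
    refine ⟨congrFun hDu 0, ?_⟩
    rw [hDu]
    exact (((hd₁ 0).hasDerivAt.const_mul _).add ((hd₂ 0).hasDerivAt.const_mul _)).deriv
  obtain ⟨h₁, h₁'⟩ := hD hμ₁ hodeμ₁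
  obtain ⟨h₂, h₂'⟩ := hD hμ₂ hodeμ₂
  rw [DD, DD, h₁, h₁', h₂, h₂']
  ring
end

section
/- Let t ∈ ℂ, t ≠ 0, λ = −t², and let V : ℝ → ℂ be continuous. (a) Suppose μ₊ : ℝ → ℂ is continuous, y ↦ e^{ty}V(y)μ₊(y) and y ↦ e^{−ty}V(y)μ₊(y) are integrable on [x,∞) for every x and y ↦ e^{ty}V(y)μ₊(y) is integrable on ℝ, and μ₊ satisfies for every x: μ₊(x) = e^{−tx} − (1/(2t))∫_x^∞ e^{−t(y−x)}V(y)μ₊(y) dy + (1/(2t))∫_x^∞ e^{t(y−x)}V(y)μ₊(y) dy. Then for all x ∈ ℝ: D(x,λ,μ₊) = e^{−tx}·(1 + (1/(2t))∫_ℝ e^{ty}V(y)μ₊(y) dy) and D'(x,λ,μ₊) = −t·D(x,λ,μ₊). (b) Suppose μ₋ : ℝ → ℂ is continuous, the analogous integrability on (−∞,x] holds together with integrability of y ↦ e^{−ty}V(y)μ₋(y) on ℝ, and μ₋ satisfies for every x: μ₋(x) = e^{tx} + (1/(2t))∫_{−∞}^x e^{−t(y−x)}V(y)μ₋(y) dy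 − (1/(2t))∫_{−∞}^x e^{t(y−x)}V(y)μ₋(y) dy. Then for all x ∈ ℝ: D(x,λ,μ₋) = e^{tx}·(1 + (1/(2t))∫_ℝ e^{−ty}V(y)μ₋(y) dy) and D'(x,λ,μ₋) = t·D(x,λ,μ₋). -/
open MeasureTheory Set Filter

theorem setIntegral_exp_mul_sub (s : ℂ) (V μ : ℝ → ℂ) (x : ℝ) (S : Set ℝ) :
    (∫ y in S, Complex.exp (s * ((y : ℂ) - (x : ℂ))) * V y * μ y) =
      Complex.exp (-s * x) * ∫ y in S, Complex.exp (s * y) * V y * μ y := by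
  rw [← integral_const_mul]
  congr 1 with y
  rw [show s * ((y : ℂ) - x) = -s * x + s * y by ring, Complex.exp_add]
  ring

theorem setIntegral_Iic_add_Ici {f : ℝ → ℂ} (hf : Integrable f) (x : ℝ) :
    (∫ y in Iic x, f y) + (∫ y in Ici x, f y) = ∫ y, f y := by
  rw [integral_Ici_eq_integral_Ioi]
  exact intervalIntegral.integral_Iic_add_Ioi hf.integrableOn hf.integrableOn

theorem deriv_exp_mul_mul_const (s c : ℂ) {f : ℝ → ℂ}
    (hf : ∀ x : ℝ, f x = Complex.exp (s * x) * c) (x : ℝ) : deriv f x = s * f x := by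
  have h : HasDerivAt (fun x : ℝ => Complex.exp (s * x) * c)
      (Complex.exp (s * x) * (s * 1) * c) x :=
    (((Complex.ofRealCLM.hasDerivAt (x := x)).const_mul s).cexp).mul_const c
  rw [funext hf, h.deriv]
  ring

/-- Let `t ≠ 0`, `λ = -t²`, `V` continuous.
(a) If a continuous `μ₊` satisfies the stated integrability conditions together with the
Jost integral equation at `+∞`, then
`D(x,λ,μ₊) = e^{-tx}(1 + (1/(2t)) ∫_ℝ e^{ty} V μ₊ dy)` and `D'(x,λ,μ₊) = -t D(x,λ,μ₊)`.
(b) Symmetrically for `μ₋` with the Jost integral equation at `-∞`: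
`D(x,λ,μ₋) = e^{tx}(1 + (1/(2t)) ∫_ℝ e^{-ty} V μ₋ dy)` and `D'(x,λ,μ₋) = t D(x,λ,μ₋)`. -/
theorem statement6 (t : ℂ) (ht : t ≠ 0) (lam : ℂ) (hlam : lam = -t ^ 2)
    (V : ℝ → ℂ) (hV : Continuous V) :
    (∀ μp : ℝ → ℂ, Continuous μp →
      (∀ x : ℝ, IntegrableOn (fun y : ℝ => Complex.exp (t * y) * V y * μp y) (Ici x)) →
      (∀ x : ℝ, IntegrableOn (fun y : ℝ => Complex.exp (-t * y) * V y * μp y) (Ici x)) →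
      Integrable (fun y : ℝ => Complex.exp (t * y) * V y * μp y) →
      (∀ x : ℝ, μp x = Complex.exp (-t * x)
        - (1 / (2 * t)) * (∫ y in Ici x, Complex.exp (-t * ((y : ℂ) - (x : ℂ))) * V y * μp y)
        + (1 / (2 * t)) * (∫ y in Ici x, Complex.exp (t * ((y : ℂ) - (x : ℂ))) * V y * μp y)) →
      (∀ x : ℝ, D t V μp x = Complex.exp (-t * x) *
          (1 + (1 / (2 * t)) * ∫ y : ℝ, Complex.exp (t * y) * V y * μp y)) ∧
      (∀ x : ℝ, deriv (D t V μp) x = -t * D t V μp x)) ∧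
    (∀ μm : ℝ → ℂ, Continuous μm →
      (∀ x : ℝ, IntegrableOn (fun y : ℝ => Complex.exp (t * y) * V y * μm y) (Iic x)) →
      (∀ x : ℝ, IntegrableOn (fun y : ℝ => Complex.exp (-t * y) * V y * μm y) (Iic x)) →
      Integrable (fun y : ℝ => Complex.exp (-t * y) * V y * μm y) →
      (∀ x : ℝ, μm x = Complex.exp (t * x)
        + (1 / (2 * t)) * (∫ y in Iic x, Complex.exp (-t * ((y : ℂ) - (x : ℂ))) * V y * μm y)
        - (1 / (2 * t)) * (∫ y in Iic x, Complex.exp (t * ((y : ℂ) - (x : ℂ))) * V y * μm y)) →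
      (∀ x : ℝ, D t V μm x = Complex.exp (t * x) *
          (1 + (1 / (2 * t)) * ∫ y : ℝ, Complex.exp (-t * y) * V y * μm y)) ∧
      (∀ x : ℝ, deriv (D t V μm) x = t * D t V μm x)) := by
  refine ⟨fun μp _ _ _ hint heq => ?_, fun μm _ _ _ hint heq => ?_⟩
  · have key : ∀ x : ℝ, D t V μp x = Complex.exp (-t * x) *
        (1 + (1 / (2 * t)) * ∫ y : ℝ, Complex.exp (t * y) * V y * μp y) := fun x => by
      rw [D, heq x, ← setIntegral_Iic_add_Ici hint x]
      simp only [setIntegral_exp_mul_sub t]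
      ring
    exact ⟨key, deriv_exp_mul_mul_const _ _ key⟩
  · have key : ∀ x : ℝ, D t V μm x = Complex.exp (t * x) *
        (1 + (1 / (2 * t)) * ∫ y : ℝ, Complex.exp (-t * y) * V y * μm y) := fun x => by
      rw [D, heq x, ← setIntegral_Iic_add_Ici hint x]
      simp only [setIntegral_exp_mul_sub (-t), neg_neg]
      ring
    exact ⟨key, deriv_exp_mul_mul_const _ _ key⟩
end

section
/- Let t ∈ ℂ with Re t > 0, λ = −t², and let V : ℝ → ℂ be continuous. Let μ₊, μ₋ : ℝ → ℂ be twice continuously differentiable solutions of μ'' + (λ − V(x))μ = 0 on ℝ such that μ₊(x)e^{tx} → 1 and μ₊'(x)e^{tx} → −t as x → +∞, the functions y ↦ e^{−ty}V(y)μ₋(y) and y ↦ e^{ty}V(y)μ₋(y) are integrable on ℝ, and μ₋ satisfies for every x: μ₋(x) = e^{tx} + (1/(2t))∫_{−∞}^x e^{−t(y−x)}V(y)μ₋(y) dy − (1/(2t))∫_{−∞}^x e^{t(y−x)}V(y)μ₋(y) dy. Then the Wronskian μ₊(x)μ₋'(x) − μ₊'(x)μ₋(x) is independent of x, and its constant value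 E(λ) satisfies E(λ) = 2t·(1 + (1/(2t))∫_ℝ e^{−ty}V(y)μ₋(y) dy). Symmetrically, if μ₋(x)e^{−tx} → 1 and μ₋'(x)e^{−tx} → t as x → −∞, the functions y ↦ e^{±ty}V(y)μ₊(y) are integrable on ℝ, and μ₊ satisfies μ₊(x) = e^{−tx} − (1/(2t))∫_x^∞ e^{−t(y−x)}V(y)μ₊(y) dy + (1/(2t))∫_x^∞ e^{t(y−x)}V(y)μ₊(y) dy for every x, then E(λ) = 2t·(1 + (1/(2t))∫_ℝ e^{ty}V(y)μ₊(y) dy). -/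
open MeasureTheory Set Filter

/-- The Wronskian of two solutions of a linear second-order equation without first-order term is
constant. -/
lemma wronskian_const {q f g : ℝ → ℂ} (hf : ContDiff ℝ 2 f) (hg : ContDiff ℝ 2 g)
    (hodef : ∀ x, deriv (deriv f) x + q x * f x = 0)
    (hodeg : ∀ x, deriv (deriv g) x + q x * g x = 0) (x₁ x₂ : ℝ) :
    f x₁ * deriv g x₁ - deriv f x₁ * g x₁ = f x₂ * deriv g x₂ - deriv f x₂ * g x₂ := by
  have hasDeriv {h : ℝ → ℂ} (hh : ContDiff ℝ 2 h) (x : ℝ) : HasDerivAt h (deriv h x) x :=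
    (hh.differentiable (by norm_num) x).hasDerivAt
  have hasDeriv₂ {h : ℝ → ℂ} (hh : ContDiff ℝ 2 h) (x : ℝ) :
      HasDerivAt (deriv h) (deriv (deriv h) x) x := by
    have : ContDiff ℝ 1 (deriv h) := ContDiff.deriv' (n := 1) hh
    exact (this.differentiable (by norm_num) x).hasDerivAt
  have key (x : ℝ) : HasDerivAt (fun x => f x * deriv g x - deriv f x * g x) 0 x := by
    refine (((hasDeriv hf x).mul (hasDeriv₂ hg x)).sub
      ((hasDeriv₂ hf x).mul (hasDeriv hg x))).congr_deriv ?_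
    linear_combination f x * hodeg x - g x * hodef x
  exact is_const_of_deriv_eq_zero (fun x => (key x).differentiableAt) (fun x => (key x).deriv) x₁ x₂

lemma hasDerivAt_integral_Iic_s7 {g : ℝ → ℂ} (hg : Continuous g) (hi : Integrable g) (x : ℝ) :
    HasDerivAt (fun u => ∫ y in Iic u, g y) (g x) x := by
  have h : (fun u => ∫ y in Iic u, g y) = fun u => (∫ y in Iic 0, g y) + ∫ y in (0 : ℝ)..u, g y := by
    funext u
    rw [← intervalIntegral.integral_Iic_sub_Iic hi.integrableOn hi.integrableOn]
    ring
  rw [h]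
  exact (intervalIntegral.integral_hasDerivAt_right (hg.intervalIntegrable _ _)
    hg.aestronglyMeasurable.stronglyMeasurableAtFilter hg.continuousAt).const_add _

lemma tendsto_integral_Iic_atTop {g : ℝ → ℂ} (hi : Integrable g) :
    Tendsto (fun u => ∫ y in Iic u, g y) atTop (nhds (∫ y, g y)) :=
  (aecover_Iic tendsto_id).integral_tendsto_of_countably_generated hi

/-- If `f` solves the Jost integral equation normalised at `-∞`, and `p`, `p'` behave like `e^{-tx}`
and its derivative at `+∞`, then `p f' - p' f` converges to the Evans function at `+∞`. -/
lemma tendsto_wronskian_of_jost {t : ℂ} (ht : 0 < t.re) {V f p p' : ℝ → ℂ}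
    (hV : Continuous V) (hf : Continuous f)
    (hp : Tendsto (fun x : ℝ => p x * Complex.exp (t * x)) atTop (nhds 1))
    (hp' : Tendsto (fun x : ℝ => p' x * Complex.exp (t * x)) atTop (nhds (-t)))
    (hm : Integrable (fun y : ℝ => Complex.exp (-t * y) * V y * f y))
    (hq : Integrable (fun y : ℝ => Complex.exp (t * y) * V y * f y))
    (heq : ∀ x : ℝ, f x = Complex.exp (t * x)
        + (1 / (2 * t)) * (∫ y in Iic x, Complex.exp (-t * ((y : ℂ) - (x : ℂ))) * V y * f y)
        - (1 / (2 * t)) * (∫ y in Iic x, Complex.exp (t * ((y : ℂ) - (x : ℂ))) * V y * f y)) :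
    Tendsto (fun x => p x * deriv f x - p' x * f x) atTop
      (nhds (2 * t * (1 + (1 / (2 * t)) * ∫ y : ℝ, Complex.exp (-t * y) * V y * f y))) := by
  have ht0 : t ≠ 0 := by
    rintro rfl
    simp at ht
  set P : ℝ → ℂ := fun x => ∫ y in Iic x, Complex.exp (-t * y) * V y * f y
  set Q : ℝ → ℂ := fun x => ∫ y in Iic x, Complex.exp (t * y) * V y * f y
  have pull (c : ℂ) (x : ℝ) : (∫ y in Iic x, Complex.exp (c * ((y : ℂ) - (x : ℂ))) * V y * f y)
      = Complex.exp (-c * x) * ∫ y in Iic x, Complex.exp (c * y) * V y * f y := by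
    rw [← integral_const_mul]
    congr 1
    funext y
    rw [show c * ((y : ℂ) - x) = -c * x + c * y by ring, Complex.exp_add]
    ring
  have hfun : f = fun x : ℝ => Complex.exp (t * x) * (1 + 1 / (2 * t) * P x)
      - 1 / (2 * t) * (Complex.exp (-t * x) * Q x) := by
    funext x
    rw [heq x, pull, pull, neg_neg]
    ring
  have hexp (c : ℂ) (x : ℝ) :
      HasDerivAt (fun x : ℝ => Complex.exp (c * x)) (Complex.exp (c * x) * c) x := by
    simpa using ((Complex.ofRealCLM.hasDerivAt (x := x)).const_mul c).cexp
  have hmul (x : ℝ) : Complex.exp (t * x) * Complex.exp (-t * x) = 1 := by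
    rw [← Complex.exp_add]
    simp
  have hderiv (x : ℝ) : deriv f x = t * Complex.exp (t * x) * (1 + 1 / (2 * t) * P x)
      + t * (1 / (2 * t) * (Complex.exp (-t * x) * Q x)) := by
    have hPd : HasDerivAt P (Complex.exp (-t * x) * V x * f x) x :=
      hasDerivAt_integral_Iic_s7 (by fun_prop) hm x
    have hQd : HasDerivAt Q (Complex.exp (t * x) * V x * f x) x :=
      hasDerivAt_integral_Iic_s7 (by fun_prop) hq x
    have := ((hexp t x).mul ((hPd.const_mul (1 / (2 * t))).const_add 1)).sub
      (((hexp (-t) x).mul hQd).const_mul (1 / (2 * t)))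
    have h2 : HasDerivAt f _ x := this.congr_of_eventuallyEq (.of_eq hfun)
    rw [h2.deriv]
    ring
  have hPlim : Tendsto P atTop (nhds (∫ y : ℝ, Complex.exp (-t * y) * V y * f y)) :=
    tendsto_integral_Iic_atTop hm
  have hQlim : Tendsto Q atTop (nhds (∫ y : ℝ, Complex.exp (t * y) * V y * f y)) :=
    tendsto_integral_Iic_atTop hq
  have hdecay : Tendsto (fun x : ℝ => Complex.exp (-t * x)) atTop (nhds 0) := by
    rw [tendsto_zero_iff_norm_tendsto_zero]
    simp only [Complex.norm_exp, Complex.re_mul_ofReal]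
    exact Real.tendsto_exp_atBot.comp (tendsto_id.const_mul_atTop_of_neg (by simpa using ht))
  have hA := (hPlim.const_mul (1 / (2 * t))).const_add 1
  have hB := ((hdecay.mul hdecay).mul hQlim).const_mul (1 / (2 * t))
  have := (hp.mul ((hA.add hB).const_mul t)).sub (hp'.mul (hA.sub hB))
  convert this using 1
  · funext x
    rw [hderiv x, congrFun hfun x]
    linear_combination (p x * t + p' x) * (1 / (2 * t)) * Complex.exp (-t * x) * Q x * (-hmul x)
  · congr 1
    ring

/-- Let `Re t > 0`, `λ = -t²`, `V` continuous and `μ₊, μ₋` C² solutions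
of `μ'' + (λ - V)μ = 0`.  Then the Wronskian `μ₊ μ₋' - μ₊' μ₋` is independent of `x`; if
moreover `μ₊ e^{tx} → 1`, `μ₊' e^{tx} → -t` at `+∞`, `e^{±ty} V μ₋` are integrable on `ℝ`
and `μ₋` satisfies its Jost integral equation, then its constant value `E(λ)` equals
`2t(1 + (1/(2t)) ∫_ℝ e^{-ty} V μ₋ dy)`; symmetrically, under the analogous hypotheses on
the other side, `E(λ) = 2t(1 + (1/(2t)) ∫_ℝ e^{ty} V μ₊ dy)`. -/
theorem statement7 (t : ℂ) (ht : 0 < t.re) (lam : ℂ) (hlam : lam = -t ^ 2)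
    (V : ℝ → ℂ) (hV : Continuous V)
    (μp μm : ℝ → ℂ) (hμp : ContDiff ℝ 2 μp) (hμm : ContDiff ℝ 2 μm)
    (hodep : ∀ x : ℝ, deriv (deriv μp) x + (lam - V x) * μp x = 0)
    (hodem : ∀ x : ℝ, deriv (deriv μm) x + (lam - V x) * μm x = 0) :
    (∀ x₁ x₂ : ℝ,
        μp x₁ * deriv μm x₁ - deriv μp x₁ * μm x₁ =
        μp x₂ * deriv μm x₂ - deriv μp x₂ * μm x₂) ∧
    ((Tendsto (fun x : ℝ => μp x * Complex.exp (t * x)) atTop (nhds 1)) →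
     (Tendsto (fun x : ℝ => deriv μp x * Complex.exp (t * x)) atTop (nhds (-t))) →
     Integrable (fun y : ℝ => Complex.exp (-t * y) * V y * μm y) →
     Integrable (fun y : ℝ => Complex.exp (t * y) * V y * μm y) →
     (∀ x : ℝ, μm x = Complex.exp (t * x)
        + (1 / (2 * t)) * (∫ y in Iic x, Complex.exp (-t * ((y : ℂ) - (x : ℂ))) * V y * μm y)
        - (1 / (2 * t)) * (∫ y in Iic x, Complex.exp (t * ((y : ℂ) - (x : ℂ))) * V y * μm y)) →
     μp 0 * deriv μm 0 - deriv μp 0 * μm 0 =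
       2 * t * (1 + (1 / (2 * t)) * ∫ y : ℝ, Complex.exp (-t * y) * V y * μm y)) ∧
    ((Tendsto (fun x : ℝ => μm x * Complex.exp (-t * x)) atBot (nhds 1)) →
     (Tendsto (fun x : ℝ => deriv μm x * Complex.exp (-t * x)) atBot (nhds t)) →
     Integrable (fun y : ℝ => Complex.exp (-t * y) * V y * μp y) →
     Integrable (fun y : ℝ => Complex.exp (t * y) * V y * μp y) →
     (∀ x : ℝ, μp x = Complex.exp (-t * x)
        - (1 / (2 * t)) * (∫ y in Ici x, Complex.exp (-t * ((y : ℂ) - (x : ℂ))) * V y * μp y)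
        + (1 / (2 * t)) * (∫ y in Ici x, Complex.exp (t * ((y : ℂ) - (x : ℂ))) * V y * μp y)) →
     μp 0 * deriv μm 0 - deriv μp 0 * μm 0 =
       2 * t * (1 + (1 / (2 * t)) * ∫ y : ℝ, Complex.exp (t * y) * V y * μp y)) := by
  have hW := wronskian_const hμp hμm hodep hodem
  refine ⟨hW, fun hp hp' hm hq heq => ?_, fun hp hp' hm hq heq => ?_⟩
  · refine tendsto_nhds_unique ?_
      (tendsto_wronskian_of_jost ht hV hμm.continuous hp hp' hm hq heq)
    simp only [hW _ 0]
    exact tendsto_const_nhds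
  · have hrefl (c : ℂ) (x : ℝ) :
        (∫ y in Iic x, Complex.exp (-c * ((y : ℂ) - (x : ℂ))) * V (-y) * μp (-y))
          = ∫ y in Ici (-x), Complex.exp (c * ((y : ℂ) - ((-x : ℝ) : ℂ))) * V y * μp y := by
      rw [integral_Ici_eq_integral_Ioi, ← integral_comp_neg_Iic]
      congr 1
      funext y
      congr 3
      push_cast
      ring
    have key := tendsto_wronskian_of_jost ht (V := fun x => V (-x)) (f := fun x => μp (-x))
      (p := fun x => μm (-x)) (p' := fun x => -deriv μm (-x)) (by fun_prop)
      (hμp.continuous.comp continuous_neg)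
      (by simpa [Function.comp_def] using hp.comp tendsto_neg_atTop_atBot)
      (by simpa [Function.comp_def] using (hp'.comp tendsto_neg_atTop_atBot).neg)
      (by simpa using hq.comp_neg) (by simpa using hm.comp_neg)
      (fun x => by
        have h := hrefl (-t) x
        rw [neg_neg] at h
        rw [hrefl, h]
        rw [heq (-x)]
        push_cast
        rw [neg_mul_neg]
        ring)
    have hI : (∫ y : ℝ, Complex.exp (-t * y) * V (-y) * μp (-y))
        = ∫ y : ℝ, Complex.exp (t * y) * V y * μp y := by
      rw [← integral_neg_eq_self]
      simp
    rw [hI] at key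
    refine tendsto_nhds_unique ?_ key
    have hd (x : ℝ) : deriv (fun x => μp (-x)) x = -deriv μp (-x) := deriv_comp_neg μp x
    have hc (x : ℝ) : μm (-x) * deriv (fun x => μp (-x)) x - -deriv μm (-x) * μp (-x)
        = μp 0 * deriv μm 0 - deriv μp 0 * μm 0 := by
      rw [hd, ← hW (-x) 0]
      ring
    simp only [hc]
    exact tendsto_const_nhds
end

section
/- Let h ∈ ℂ with h ≠ 0, let λ ∈ ℂ with λ ≠ 0 and λ ≠ h, and let s, t ∈ ℂ satisfy s² = h − λ and t² = −λ (so s, t ≠ 0 and s ≠ ±t). Let a₁ < a₂ be real numbers and C₁, C₂ ∈ ℂ. Then the identity −2t·(C₁e^{sx} + C₂e^{−sx}) = h·( ∫_x^{a₂} e^{−t(y−x)}(C₁e^{sy} + C₂e^{−sy}) dy + ∫_{a₁}^x e^{t(y−x)}(C₁e^{sy} + C₂e^{−sy}) dy ) holds for all x ∈ (a₁, a₂) if and only if both of the following hold: C₁·e^{(s−t)a₂}/(s−t) = C₂·e^{−(s+t)a₂}/(s+t) and C₁·e^{(s+t)a₁}/(s+t) = C₂·e^{−(s−t)a₁}/(s−t).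 -/
open MeasureTheory

/-- The integral of `e^{c(y-x)}(C₁e^{sy} + C₂e^{-sy})` over `[a, b]` when neither `s` nor `-s`
cancels `c`. -/
lemma integral_exp_mul_exp_add_exp (c s C₁ C₂ : ℂ) (hp : s + c ≠ 0) (hm : s - c ≠ 0)
    (a b x : ℝ) :
    (∫ y in a..b, Complex.exp (c * ((y : ℂ) - (x : ℂ))) *
        (C₁ * Complex.exp (s * y) + C₂ * Complex.exp (-s * y))) =
      Complex.exp (-c * x) *
        (C₁ * ((Complex.exp ((s + c) * b) - Complex.exp ((s + c) * a)) / (s + c)) -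
          C₂ * ((Complex.exp (-(s - c) * b) - Complex.exp (-(s - c) * a)) / (s - c))) := by
  have integrand_eq (y : ℝ) : Complex.exp (c * ((y : ℂ) - (x : ℂ))) *
        (C₁ * Complex.exp (s * y) + C₂ * Complex.exp (-s * y)) =
      Complex.exp (-c * x) *
        (C₁ * Complex.exp ((s + c) * y) + C₂ * Complex.exp (-(s - c) * y)) := by
    rw [show c * ((y : ℂ) - x) = -c * x + c * y by ring,
      show (s + c) * (y : ℂ) = c * y + s * y by ring,
      show -(s - c) * (y : ℂ) = c * y + -s * y by ring]
    simp only [Complex.exp_add]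
    ring
  simp_rw [integrand_eq]
  rw [intervalIntegral.integral_const_mul, intervalIntegral.integral_add
      ((by fun_prop : Continuous fun y : ℝ =>
        C₁ * Complex.exp ((s + c) * y)).intervalIntegrable a b)
      ((by fun_prop : Continuous fun y : ℝ =>
        C₂ * Complex.exp (-(s - c) * y)).intervalIntegrable a b),
    intervalIntegral.integral_const_mul, intervalIntegral.integral_const_mul,
    integral_exp_mul_complex hp, integral_exp_mul_complex (neg_ne_zero.mpr hm), div_neg]
  ring

/-- The functions `e^{tx}` and `e^{-tx}` are linearly independent on every nonempty open interval
when `t ≠ 0`. -/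
lemma forall_mem_Ioo_exp_mul_eq_iff {t : ℂ} (ht : t ≠ 0) {a b : ℝ} (hab : a < b) (A B : ℂ) :
    (∀ x ∈ Set.Ioo a b, Complex.exp (t * x) * A = Complex.exp (-t * x) * B) ↔
      A = 0 ∧ B = 0 := by
  refine ⟨fun H => ?_, by rintro ⟨rfl, rfl⟩; simp⟩
  obtain ⟨m, hm⟩ := Set.nonempty_Ioo.mpr hab
  have const_of_mem : ∀ x ∈ Set.Ioo a b, Complex.exp (2 * t * x) * A = B := by
    intro x hx
    rw [show 2 * t * (x : ℂ) = t * x + t * x by ring, Complex.exp_add, mul_assoc, H x hx,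
      ← mul_assoc, ← Complex.exp_add]
    simp
  have deriv_const : HasDerivAt (fun x : ℝ => Complex.exp (2 * t * x) * A) 0 m :=
    (hasDerivAt_const m B).congr_of_eventuallyEq
      (Filter.eventually_of_mem (isOpen_Ioo.mem_nhds hm) const_of_mem)
  have deriv_exp : HasDerivAt (fun x : ℝ => Complex.exp (2 * t * x) * A)
      (Complex.exp (2 * t * m) * (2 * t * 1) * A) m :=
    (((hasDerivAt_id m).ofReal_comp.const_mul (2 * t)).cexp).mul_const A
  have hA : A = 0 := by
    simpa [ht, Complex.exp_ne_zero] using deriv_exp.unique deriv_const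
  exact ⟨hA, by simpa [hA] using (const_of_mem m hm).symm⟩

/-- Let `h ≠ 0`, `λ ∉ {0, h}`, `s² = h - λ`, `t² = -λ`, `a₁ < a₂` and
`C₁, C₂ ∈ ℂ`.  The identity
`-2t(C₁e^{sx} + C₂e^{-sx}) = h(∫_x^{a₂} e^{-t(y-x)}(C₁e^{sy}+C₂e^{-sy}) dy +
∫_{a₁}^x e^{t(y-x)}(C₁e^{sy}+C₂e^{-sy}) dy)` holds for all `x ∈ (a₁,a₂)` iff
`C₁e^{(s-t)a₂}/(s-t) = C₂e^{-(s+t)a₂}/(s+t)` and `C₁e^{(s+t)a₁}/(s+t) = C₂e^{-(s-t)a₁}/(s-t)`. -/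
theorem statement12 (h lam : ℂ) (hh : h ≠ 0) (hlam0 : lam ≠ 0) (hlamh : lam ≠ h)
    (s t : ℂ) (hs : s ^ 2 = h - lam) (ht : t ^ 2 = -lam)
    (a₁ a₂ : ℝ) (ha : a₁ < a₂) (C₁ C₂ : ℂ) :
    (∀ x ∈ Set.Ioo a₁ a₂,
      -2 * t * (C₁ * Complex.exp (s * x) + C₂ * Complex.exp (-s * x)) =
        h * ((∫ y in x..a₂, Complex.exp (-t * ((y : ℂ) - (x : ℂ))) *
                (C₁ * Complex.exp (s * y) + C₂ * Complex.exp (-s * y))) +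
             (∫ y in a₁..x, Complex.exp (t * ((y : ℂ) - (x : ℂ))) *
                (C₁ * Complex.exp (s * y) + C₂ * Complex.exp (-s * y))))) ↔
    (C₁ * Complex.exp ((s - t) * a₂) / (s - t) = C₂ * Complex.exp (-(s + t) * a₂) / (s + t) ∧
     C₁ * Complex.exp ((s + t) * a₁) / (s + t) = C₂ * Complex.exp (-(s - t) * a₁) / (s - t)) := by
  have hpq : (s - t) * (s + t) = h := by linear_combination hs - ht
  have hp : s - t ≠ 0 := left_ne_zero_of_mul (hpq ▸ hh)
  have hq : s + t ≠ 0 := right_ne_zero_of_mul (hpq ▸ hh)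
  have ht0 : t ≠ 0 := by
    rintro rfl
    exact hlam0 (by simpa using ht.symm)
  rw [← sub_eq_zero (a := C₁ * Complex.exp ((s - t) * a₂) / (s - t)),
    ← sub_eq_zero (a := C₁ * Complex.exp ((s + t) * a₁) / (s + t)),
    ← forall_mem_Ioo_exp_mul_eq_iff ht0 ha]
  refine forall₂_congr fun x _ => ?_
  rw [integral_exp_mul_exp_add_exp (-t) s C₁ C₂ (by rwa [← sub_eq_add_neg])
      (by rwa [sub_neg_eq_add]),
    integral_exp_mul_exp_add_exp t s C₁ C₂ hq hp]
  simp only [neg_neg, sub_neg_eq_add, ← sub_eq_add_neg]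
  have exp_p : Complex.exp (t * x) * Complex.exp ((s - t) * x) = Complex.exp (s * x) := by
    rw [← Complex.exp_add]; ring_nf
  have exp_neg_q : Complex.exp (t * x) * Complex.exp (-(s + t) * x) = Complex.exp (-s * x) := by
    rw [← Complex.exp_add]; ring_nf
  have exp_q : Complex.exp (-t * x) * Complex.exp ((s + t) * x) = Complex.exp (s * x) := by
    rw [← Complex.exp_add]; ring_nf
  have exp_neg_p : Complex.exp (-t * x) * Complex.exp (-(s - t) * x) = Complex.exp (-s * x) := by
    rw [← Complex.exp_add]; ring_nf
  generalize Complex.exp (t * x) = E at *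
  generalize Complex.exp (-t * x) = F at *
  generalize Complex.exp ((s - t) * x) = P at *
  generalize Complex.exp (-(s - t) * x) = P' at *
  generalize Complex.exp ((s + t) * x) = Q at *
  generalize Complex.exp (-(s + t) * x) = Q' at *
  generalize Complex.exp (s * x) = S at *
  generalize Complex.exp (-s * x) = S' at *
  rw [← hpq, ← sub_eq_zero, ← sub_eq_zero (a := E * _),
    ← mul_eq_zero_iff_left (mul_ne_zero hp hq) (b := E * _ - _), ← neg_eq_zero]
  refine Eq.congr ?_ rfl
  field_simp
  linear_combination (-(C₁ * (s + t))) * exp_p + C₁ * (s - t) * exp_q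
    + C₂ * (s - t) * exp_neg_q - C₂ * (s + t) * exp_neg_p
end

section
/- Let h ∈ ℂ with h ≠ 0, let λ ∈ ℂ with λ ≠ 0 and λ ≠ h, let s, t ∈ ℂ satisfy s² = h − λ and t² = −λ, and let a₁ < a₂ be real numbers. Then there exists a pair (C₁, C₂) ∈ ℂ² with (C₁, C₂) ≠ (0,0) satisfying C₁·e^{(s−t)a₂}/(s−t) = C₂·e^{−(s+t)a₂}/(s+t) and C₁·e^{(s+t)a₁}/(s+t) = C₂·e^{−(s−t)a₁}/(s−t) if and only if e^{2s(a₂−a₁)} = (s−t)⁴/h². -/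
/-- The linear system `C₁ A q = C₂ p`, `C₁ B p = C₂ q` has a nonzero solution iff its
determinant vanishes. -/
lemma exists_ne_zero_solution_iff {p q A B : ℂ} (hp : p ≠ 0) :
    (∃ C₁ C₂ : ℂ, (C₁, C₂) ≠ (0, 0) ∧ C₁ * A * q = C₂ * p ∧ C₁ * B * p = C₂ * q) ↔
      A * q ^ 2 = B * p ^ 2 := by
  constructor
  · rintro ⟨C₁, C₂, hne, h₁, h₂⟩
    have hC : C₁ ≠ 0 := by
      rintro rfl
      have hC₂ : C₂ = 0 := by simpa [hp] using h₁.symm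
      exact hne (by rw [hC₂])
    apply mul_left_cancel₀ hC
    linear_combination q * h₁ - p * h₂
  · intro hdet
    exact ⟨p, A * q, by simp [hp], by ring, by linear_combination -hdet⟩

/-- A factor `u = v w` with `w ≠ 0` may be cancelled from `x u / p = y w / q`. -/
lemma mul_div_eq_mul_div_iff_of_eq_mul {p q u v w x y : ℂ} (hp : p ≠ 0) (hq : q ≠ 0)
    (hw : w ≠ 0) (hu : u = v * w) : x * u / p = y * w / q ↔ x * v * q = y * p := by
  rw [div_eq_div_iff hp hq, hu, ← mul_left_inj' hw (a := x * v * q)]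
  ring_nf

/-- Let `h ≠ 0`, `λ ∉ {0, h}`, `s² = h - λ`, `t² = -λ` and `a₁ < a₂`.
There exists `(C₁, C₂) ≠ (0,0)` with `C₁e^{(s-t)a₂}/(s-t) = C₂e^{-(s+t)a₂}/(s+t)` and
`C₁e^{(s+t)a₁}/(s+t) = C₂e^{-(s-t)a₁}/(s-t)` iff `e^{2s(a₂-a₁)} = (s-t)⁴/h²`. -/
theorem statement13 (h lam : ℂ) (hh : h ≠ 0) (hlam0 : lam ≠ 0) (hlamh : lam ≠ h)
    (s t : ℂ) (hs : s ^ 2 = h - lam) (ht : t ^ 2 = -lam)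
    (a₁ a₂ : ℝ) (ha : a₁ < a₂) :
    (∃ C₁ C₂ : ℂ, (C₁, C₂) ≠ (0, 0) ∧
      C₁ * Complex.exp ((s - t) * a₂) / (s - t) = C₂ * Complex.exp (-(s + t) * a₂) / (s + t) ∧
      C₁ * Complex.exp ((s + t) * a₁) / (s + t) = C₂ * Complex.exp (-(s - t) * a₁) / (s - t)) ↔
    Complex.exp (2 * s * ((a₂ : ℂ) - (a₁ : ℂ))) = (s - t) ^ 4 / h ^ 2 := by
  have hpq : (s - t) * (s + t) = h := by linear_combination hs - ht
  have hp : s - t ≠ 0 := left_ne_zero_of_mul (hpq ▸ hh)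
  have hq : s + t ≠ 0 := right_ne_zero_of_mul (hpq ▸ hh)
  have h₂ : Complex.exp ((s - t) * a₂) =
      Complex.exp (2 * s * a₂) * Complex.exp (-(s + t) * a₂) := by
    rw [← Complex.exp_add]; ring_nf
  have h₁ : Complex.exp ((s + t) * a₁) =
      Complex.exp (2 * s * a₁) * Complex.exp (-(s - t) * a₁) := by
    rw [← Complex.exp_add]; ring_nf
  simp_rw [mul_div_eq_mul_div_iff_of_eq_mul hp hq (Complex.exp_ne_zero _) h₂,
    mul_div_eq_mul_div_iff_of_eq_mul hq hp (Complex.exp_ne_zero _) h₁]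
  have hquot : (s - t) ^ 4 / h ^ 2 = (s - t) ^ 2 / (s + t) ^ 2 := by
    rw [← hpq]; field_simp
  rw [exists_ne_zero_solution_iff hp, hquot, mul_sub, Complex.exp_sub,
    div_eq_div_iff (Complex.exp_ne_zero _) (pow_ne_zero 2 hq), mul_comm ((s - t) ^ 2)]
end

section
/- Let h < 0, L > 0, and let r be a real number with 0 < r < −h. Set k = √(−r−h) > 0. Then the complex equation e^{2ikL} = (ik − √r)⁴/h² holds if and only if k·sin(kL/2) = √r·cos(kL/2) or k·cos(kL/2) = −√r·sin(kL/2); equivalently, tan(kL/2) = √r/k or cot(kL/2) = −√r/k. -/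
/-- A fourth-power identity for `z = c + i d` on the unit circle and `w = i k - s`. -/
lemma Complex.pow_four_mul_sub_pow_four {c d k s : ℂ} (hcd : c ^ 2 + d ^ 2 = 1) :
    (c + d * Complex.I) ^ 4 * (k ^ 2 + s ^ 2) ^ 2 - (Complex.I * k - s) ^ 4 =
      -4 * Complex.I * ((c + d * Complex.I) * (Complex.I * k - s)) ^ 2 *
        ((k * d - s * c) * (k * c + s * d)) := by
  have hI : Complex.I ^ 2 = -1 := Complex.I_sq
  have hH : k ^ 2 + s ^ 2 = (Complex.I * k - s) * (-Complex.I * k - s) := by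
    linear_combination k ^ 2 * hI
  have hz : (c + d * Complex.I) * (c - d * Complex.I) = 1 := by
    linear_combination hcd - d ^ 2 * hI
  have hsub : (c + d * Complex.I) ^ 2 * (k ^ 2 + s ^ 2) - (Complex.I * k - s) ^ 2 =
      -2 * Complex.I * ((c + d * Complex.I) * (Complex.I * k - s)) * (k * c + s * d) := by
    rw [hH]
    linear_combination (Complex.I * k - s) ^ 2 * hz
  have hadd : (c + d * Complex.I) ^ 2 * (k ^ 2 + s ^ 2) + (Complex.I * k - s) ^ 2 =
      2 * ((c + d * Complex.I) * (Complex.I * k - s)) * (k * d - s * c) := by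
    rw [hH]
    linear_combination -(Complex.I * k - s) ^ 2 * hz -
      2 * ((c + d * Complex.I) * (Complex.I * k - s)) * k * d * hI
  linear_combination hsub * ((c + d * Complex.I) ^ 2 * (k ^ 2 + s ^ 2) + (Complex.I * k - s) ^ 2) +
    (-2 * Complex.I * ((c + d * Complex.I) * (Complex.I * k - s)) * (k * c + s * d)) * hadd

/-- Let `h < 0`, `L > 0`, `0 < r < -h` and `k = √(-r-h)`.  Then
`e^{2ikL} = (ik - √r)⁴/h²` iff `k sin(kL/2) = √r cos(kL/2)` or
`k cos(kL/2) = -√r sin(kL/2)`. -/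
theorem statement14 (h L r : ℝ) (hh : h < 0) (hL : 0 < L) (hr : 0 < r) (hrh : r < -h)
    (k : ℝ) (hk : k = Real.sqrt (-r - h)) :
    Complex.exp (2 * Complex.I * k * L) = (Complex.I * k - (Real.sqrt r : ℂ)) ^ 4 / (h : ℂ) ^ 2 ↔
    (k * Real.sin (k * L / 2) = Real.sqrt r * Real.cos (k * L / 2) ∨
     k * Real.cos (k * L / 2) = -Real.sqrt r * Real.sin (k * L / 2)) := by
  have hs : Real.sqrt r ^ 2 = r := Real.sq_sqrt hr.le
  have hk2 : k ^ 2 = -r - h := by rw [hk, Real.sq_sqrt (by linarith)]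
  have hspos : 0 < Real.sqrt r := Real.sqrt_pos.mpr hr
  generalize Real.sqrt r = s at *
  have hhC : (h : ℂ) ^ 2 ≠ 0 := pow_ne_zero 2 (Complex.ofReal_ne_zero.mpr hh.ne)
  have hsum : (h : ℂ) ^ 2 = ((k : ℂ) ^ 2 + (s : ℂ) ^ 2) ^ 2 := by
    have : h ^ 2 = (k ^ 2 + s ^ 2) ^ 2 := by rw [hk2, hs]; ring
    exact_mod_cast this
  have hexp : Complex.exp (2 * Complex.I * k * L) =
      (Real.cos (k * L / 2) + Real.sin (k * L / 2) * Complex.I : ℂ) ^ 4 := by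
    rw [Complex.ofReal_cos, Complex.ofReal_sin, ← Complex.exp_mul_I, ← Complex.exp_nat_mul]
    congr 1
    push_cast
    ring
  have hcd : (Real.cos (k * L / 2) : ℂ) ^ 2 + (Real.sin (k * L / 2) : ℂ) ^ 2 = 1 := by
    exact_mod_cast Real.cos_sq_add_sin_sq (k * L / 2)
  have hz : (Real.cos (k * L / 2) + Real.sin (k * L / 2) * Complex.I : ℂ) ≠ 0 := by
    rw [Complex.ofReal_cos, Complex.ofReal_sin, ← Complex.exp_mul_I]
    exact Complex.exp_ne_zero _
  have hw : Complex.I * k - (s : ℂ) ≠ 0 := fun h0 => by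
    have := congrArg Complex.re h0
    simp at this
    exact hspos.ne' this
  rw [eq_div_iff hhC, hexp, hsum, ← sub_eq_zero, Complex.pow_four_mul_sub_pow_four hcd,
    mul_eq_zero_iff_left (mul_ne_zero (by simp) (pow_ne_zero 2 (mul_ne_zero hz hw))), mul_eq_zero]
  norm_cast
  rw [sub_eq_zero, neg_mul, eq_neg_iff_add_eq_zero]
end

section
/- Let h < 0, L > 0, and let r be a real number with 0 < r < −h. Set k = √(−r−h) > 0. Then the complex equation e^{2ikL} = (ik + √r)⁴/h² holds if and only if k·sin(kL/2) = −√r·cos(kL/2) or k·cos(kL/2) = √r·sin(kL/2); equivalently, tan(kL/2) = −√r/k or cot(kL/2) = √r/k. -/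
/-- A complex number `a + bi` satisfies `(a + bi)⁴ = |a + bi|⁴` iff it lies on a coordinate axis. -/
theorem Complex.add_mul_I_pow_four_eq_iff (a b : ℝ) :
    ((a : ℂ) + b * Complex.I) ^ 4 = ((a : ℂ) ^ 2 + (b : ℂ) ^ 2) ^ 2 ↔ a = 0 ∨ b = 0 := by
  have key : ((a : ℂ) + b * Complex.I) ^ 4 - ((a : ℂ) ^ 2 + (b : ℂ) ^ 2) ^ 2 =
      ((-8 * (a * b) ^ 2 : ℝ) : ℂ) + ((4 * (a * b) * (a ^ 2 - b ^ 2) : ℝ) : ℂ) * Complex.I := by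
    push_cast
    linear_combination (6 * (a : ℂ) ^ 2 * b ^ 2 + 4 * a * b ^ 3 * Complex.I +
      b ^ 4 * (Complex.I ^ 2 - 1)) * Complex.I_sq
  rw [← sub_eq_zero, key, ← mul_eq_zero]
  constructor
  · intro H
    have hre := congrArg Complex.re H
    rw [Complex.add_re, Complex.ofReal_re, Complex.re_ofReal_mul, Complex.I_re] at hre
    rw [Complex.zero_re, mul_zero, add_zero] at hre
    exact pow_eq_zero_iff two_ne_zero |>.mp (by linarith)
  · intro H
    simp [H]

/-- Let `h < 0`, `L > 0`, `0 < r < -h` and `k = √(-r-h)`.  Then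
`e^{2ikL} = (ik + √r)⁴/h²` iff `k sin(kL/2) = -√r cos(kL/2)` or
`k cos(kL/2) = √r sin(kL/2)`. -/
theorem statement15 (h L r : ℝ) (hh : h < 0) (hL : 0 < L) (hr : 0 < r) (hrh : r < -h)
    (k : ℝ) (hk : k = Real.sqrt (-r - h)) :
    Complex.exp (2 * Complex.I * k * L) = (Complex.I * k + (Real.sqrt r : ℂ)) ^ 4 / (h : ℂ) ^ 2 ↔
    (k * Real.sin (k * L / 2) = -Real.sqrt r * Real.cos (k * L / 2) ∨
     k * Real.cos (k * L / 2) = Real.sqrt r * Real.sin (k * L / 2)) := by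
  have hk2 : k ^ 2 = -r - h := by rw [hk, Real.sq_sqrt (by linarith)]
  have hs2 : Real.sqrt r ^ 2 = r := Real.sq_sqrt hr.le
  generalize Real.sqrt r = s at *
  have hexp : Complex.exp (2 * Complex.I * k * L) =
      ((Real.cos (k * L / 2) : ℂ) + Real.sin (k * L / 2) * Complex.I) ^ 4 := by
    rw [Complex.ofReal_cos, Complex.ofReal_sin, ← Complex.exp_mul_I, ← Complex.exp_nat_mul]
    congr 1
    push_cast
    ring
  rw [hexp]
  have hcs := Real.sin_sq_add_cos_sq (k * L / 2)
  generalize Real.cos (k * L / 2) = c at *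
  generalize Real.sin (k * L / 2) = d at *
  have hh0 : (h : ℂ) ≠ 0 := by exact_mod_cast hh.ne
  have hnorm : (Complex.I * k + (s : ℂ)) * (s - Complex.I * k) = -h := by
    have : (k : ℂ) ^ 2 + (s : ℂ) ^ 2 = -h := by
      exact_mod_cast (by linarith : k ^ 2 + s ^ 2 = -h)
    linear_combination this - (k : ℂ) ^ 2 * Complex.I_sq
  have hconj : (s : ℂ) - Complex.I * k ≠ 0 :=
    right_ne_zero_of_mul (hnorm.trans_ne (neg_ne_zero.mpr hh0))
  have hu : ((c : ℂ) + d * Complex.I) * (s - Complex.I * k) =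
      ((c * s + d * k : ℝ) : ℂ) + ((d * s - c * k : ℝ) : ℂ) * Complex.I := by
    push_cast
    linear_combination -(d : ℂ) * k * Complex.I_sq
  have hmod : (((c * s + d * k : ℝ) : ℂ) ^ 2 + ((d * s - c * k : ℝ) : ℂ) ^ 2) ^ 2 =
      (h : ℂ) ^ 2 := by
    have : (c * s + d * k) ^ 2 + (d * s - c * k) ^ 2 = -h := by
      linear_combination (k ^ 2 + s ^ 2) * hcs + hk2 + hs2
    have hC := congrArg (fun x : ℝ => (x : ℂ) ^ 2) this
    push_cast at hC ⊢
    rw [hC, neg_sq]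
  have hz : (Complex.I * k + (s : ℂ)) ^ 4 / (h : ℂ) ^ 2 * (s - Complex.I * k) ^ 4 =
      (h : ℂ) ^ 2 := by
    rw [div_mul_eq_mul_div, ← mul_pow, hnorm]
    field_simp
  rw [← mul_left_inj' (pow_ne_zero 4 hconj), hz, ← mul_pow, hu, ← hmod,
    Complex.add_mul_I_pow_four_eq_iff]
  refine or_congr ?_ ?_ <;> constructor <;> intro H <;> linarith
end

section
/- Let h < 0 and L > 0. Then the set of r ∈ (0, −h) satisfying √(−r−h)·sin(L√(−r−h)/2) = √r·cos(L√(−r−h)/2), together with the set of r ∈ (0, −h) satisfying √(−r−h)·cos(L√(−r−h)/2) = −√r·sin(L√(−r−h)/2), is a finite set. (Equivalently: the equations tan(L√(−r−h)/2) = √r/√(−r−h) and cot(L√(−r−h)/2) = −√r/√(−r−h) have only finitely many roots r in the interval (0, −h).) -/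
/-- The phase `L √(-r-h) / 2 - φ`, where `(√(-r-h), √r) = √(-h) (cos φ, sin φ)`. -/
noncomputable def wellPhase (h L r : ℝ) : ℝ :=
  L * Real.sqrt (-r - h) / 2 - Real.arccos (Real.sqrt (-r - h) / Real.sqrt (-h))

theorem wellPhase_strictAntiOn {h L : ℝ} (hL : 0 < L) :
    StrictAntiOn (wellPhase h L) (Set.Ioo 0 (-h)) := by
  rintro a ⟨ha, -⟩ b ⟨-, hb⟩ hab
  have hlt : Real.sqrt (-b - h) < Real.sqrt (-a - h) :=
    Real.sqrt_lt_sqrt (by linarith) (by linarith)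
  have harc : Real.arccos (Real.sqrt (-a - h) / Real.sqrt (-h)) ≤
      Real.arccos (Real.sqrt (-b - h) / Real.sqrt (-h)) :=
    Real.arccos_le_arccos (by gcongr)
  have hmul := mul_lt_mul_of_pos_left hlt hL
  unfold wellPhase
  linarith

theorem wellPhase_mem_Icc {h L r : ℝ} (hL : 0 < L) (hr : 0 < r) :
    wellPhase h L r ∈ Set.Icc (-Real.pi) (L * Real.sqrt (-h) / 2) := by
  have hle : Real.sqrt (-r - h) ≤ Real.sqrt (-h) := Real.sqrt_le_sqrt (by linarith)
  have hmul := mul_le_mul_of_nonneg_left hle hL.le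
  have hnn : 0 ≤ L * Real.sqrt (-r - h) := by positivity
  have h0 := Real.arccos_nonneg (Real.sqrt (-r - h) / Real.sqrt (-h))
  have hpi := Real.arccos_le_pi (Real.sqrt (-r - h) / Real.sqrt (-h))
  constructor <;> unfold wellPhase <;> linarith

theorem sqrt_mul_cos_arccos {h r : ℝ} (hr : r ∈ Set.Ioo 0 (-h)) :
    Real.sqrt (-h) * Real.cos (Real.arccos (Real.sqrt (-r - h) / Real.sqrt (-h))) =
      Real.sqrt (-r - h) := by
  obtain ⟨h0, h1⟩ := hr
  have hc : 0 < Real.sqrt (-h) := Real.sqrt_pos.2 (by linarith)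
  have hle : Real.sqrt (-r - h) ≤ Real.sqrt (-h) := Real.sqrt_le_sqrt (by linarith)
  have hnn : 0 ≤ Real.sqrt (-r - h) / Real.sqrt (-h) := by positivity
  rw [Real.cos_arccos (by linarith) ((div_le_one hc).2 hle)]
  field_simp

theorem sqrt_mul_sin_arccos {h r : ℝ} (hr : r ∈ Set.Ioo 0 (-h)) :
    Real.sqrt (-h) * Real.sin (Real.arccos (Real.sqrt (-r - h) / Real.sqrt (-h))) =
      Real.sqrt r := by
  obtain ⟨h0, h1⟩ := hr
  have hh : 0 < -h := by linarith
  rw [Real.sin_arccos, div_pow, Real.sq_sqrt (by linarith), Real.sq_sqrt hh.le,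
    ← Real.sqrt_mul hh.le]
  congr 1
  have : h ≠ 0 := by linarith
  field_simp
  ring

theorem sin_two_mul_wellPhase {h L r : ℝ} (hr : r ∈ Set.Ioo 0 (-h))
    (heq : Real.sqrt (-r - h) * Real.sin (L * Real.sqrt (-r - h) / 2) =
        Real.sqrt r * Real.cos (L * Real.sqrt (-r - h) / 2) ∨
      Real.sqrt (-r - h) * Real.cos (L * Real.sqrt (-r - h) / 2) =
        -Real.sqrt r * Real.sin (L * Real.sqrt (-r - h) / 2)) :
    Real.sin (2 * wellPhase h L r) = 0 := by
  have hc : Real.sqrt (-h) ≠ 0 := (Real.sqrt_pos.2 (hr.1.trans hr.2)).ne'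
  have hcos := sqrt_mul_cos_arccos hr
  have hsin := sqrt_mul_sin_arccos hr
  rw [Real.sin_two_mul]
  rcases heq with heq | heq
  · have : Real.sin (wellPhase h L r) = 0 := by
      refine (mul_eq_zero.1 (?_ : Real.sqrt (-h) * _ = 0)).resolve_left hc
      rw [wellPhase, Real.sin_sub]
      linear_combination heq + Real.sin (L * Real.sqrt (-r - h) / 2) * hcos -
        Real.cos (L * Real.sqrt (-r - h) / 2) * hsin
    simp [this]
  · have : Real.cos (wellPhase h L r) = 0 := by
      refine (mul_eq_zero.1 (?_ : Real.sqrt (-h) * _ = 0)).resolve_left hc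
      rw [wellPhase, Real.cos_sub]
      linear_combination heq + Real.cos (L * Real.sqrt (-r - h) / 2) * hcos +
        Real.sin (L * Real.sqrt (-r - h) / 2) * hsin
    simp [this]

/-- For `h < 0` and `L > 0`, the set of `r ∈ (0,-h)` satisfying
`√(-r-h) sin(L√(-r-h)/2) = √r cos(L√(-r-h)/2)` together with the set of `r ∈ (0,-h)`
satisfying `√(-r-h) cos(L√(-r-h)/2) = -√r sin(L√(-r-h)/2)` is finite. -/
theorem statement16 (h L : ℝ) (hh : h < 0) (hL : 0 < L) :
    Set.Finite
      ({r : ℝ | r ∈ Set.Ioo 0 (-h) ∧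
          Real.sqrt (-r - h) * Real.sin (L * Real.sqrt (-r - h) / 2) =
            Real.sqrt r * Real.cos (L * Real.sqrt (-r - h) / 2)} ∪
       {r : ℝ | r ∈ Set.Ioo 0 (-h) ∧
          Real.sqrt (-r - h) * Real.cos (L * Real.sqrt (-r - h) / 2) =
            -Real.sqrt r * Real.sin (L * Real.sqrt (-r - h) / 2)}) := by
  rw [← Set.ofPred_or]
  simp only [← and_or_left]
  refine Set.Finite.of_finite_image (f := wellPhase h L) ?_
    ((wellPhase_strictAntiOn hL).injOn.mono fun r hr => hr.1)
  refine ((Set.finite_Icc (-2 : ℤ) ⌊L * Real.sqrt (-h) / Real.pi⌋).image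
    fun n : ℤ => n * Real.pi / 2).subset ?_
  rintro _ ⟨r, ⟨hr, heq⟩, rfl⟩
  obtain ⟨n, hn⟩ := Real.sin_eq_zero_iff.1 (sin_two_mul_wellPhase hr heq)
  obtain ⟨hlo, hhi⟩ := wellPhase_mem_Icc (h := h) hL hr.1
  refine ⟨n, ⟨?_, ?_⟩, by dsimp only; linarith⟩
  · have : (-2 : ℝ) ≤ n := le_of_mul_le_mul_right (by linarith) Real.pi_pos
    exact_mod_cast this
  · rw [Int.le_floor, le_div_iff₀ Real.pi_pos]
    linarith
end

section
/- Let h < 0 and let a₁ < a₂ be real numbers. Then the set of λ ∈ ℂ with Im λ > 0 for which there exist s, t ∈ ℂ with s² = h − λ, t² = −λ, Re t < 0 and e^{2s(a₂−a₁)} = (s−t)⁴/h² is infinite; likewise the corresponding set of λ ∈ ℂ with Im λ < 0 is infinite. -/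
/-- A point `z = x + iy` with `0 < y < π / 2` and arbitrarily large real part such that
`c sinh z = z + iπm/2` for some natural number `m`. -/
lemma exists_sinh_eq_add (c X : ℝ) (hc : 0 < c) : ∃ (x y : ℝ) (m : ℕ), X ≤ x ∧ 0 < x ∧ 0 < y ∧
    y < Real.pi / 2 ∧ c * Real.sinh x * Real.cos y = x ∧
    c * Real.cosh x * Real.sin y = y + Real.pi * m / 2 := by
  set A : ℝ := max X (8 / c) with hA
  have hA8 : 8 / c ≤ A := le_max_right _ _
  have hA0 : 0 < A := lt_of_lt_of_le (by positivity) hA8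
  have sinh_lower : ∀ x, A ≤ x → x ^ 2 / 4 ≤ Real.sinh x := by
    intro x hx
    have h1 := Real.quadratic_le_exp_of_nonneg (hA0.le.trans hx)
    have h2 : Real.exp (-x) ≤ 1 := Real.exp_le_one_iff.2 (by linarith)
    rw [Real.sinh_eq]
    linarith
  have sinh_pos : ∀ x, A ≤ x → 0 < Real.sinh x := fun x hx =>
    Real.sinh_pos_iff.2 (hA0.trans_le hx)
  set q : ℝ → ℝ := fun x => x / (c * Real.sinh x) with hq
  have q_pos : ∀ x, A ≤ x → 0 < q x := fun x hx =>
    div_pos (hA0.trans_le hx) (mul_pos hc (sinh_pos x hx))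
  have q_le : ∀ x, A ≤ x → q x ≤ 1 / 2 := by
    intro x hx
    have h0 : 0 < x := hA0.trans_le hx
    have h8 : 8 ≤ x * c := (div_le_iff₀ hc).1 (hA8.trans hx)
    rw [hq]
    simp only
    rw [div_le_iff₀ (mul_pos hc (sinh_pos x hx))]
    have h1 := mul_le_mul_of_nonneg_left (sinh_lower x hx) hc.le
    nlinarith [mul_le_mul_of_nonneg_left h8 h0.le]
  set G : ℝ → ℝ := fun x =>
    c * Real.cosh x * Real.sin (Real.arccos (q x)) - Real.arccos (q x) with hG
  have G_lower : ∀ x, A ≤ x → c * x / 2 - Real.pi ≤ G x := by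
    intro x hx
    have h0 : 0 < x := hA0.trans_le hx
    have hp := q_pos x hx
    have hl := q_le x hx
    have h1 : 1 / 2 ≤ Real.sin (Real.arccos (q x)) := by
      rw [Real.sin_arccos]
      apply Real.le_sqrt_of_sq_le
      nlinarith
    have h2 : x ≤ Real.cosh x :=
      (Real.self_le_sinh_iff.2 h0.le).trans (Real.sinh_lt_cosh x).le
    have h3 : c * x * (1 / 2) ≤ c * Real.cosh x * Real.sin (Real.arccos (q x)) := by
      gcongr
    have h4 := Real.arccos_le_pi (q x)
    simp only [hG]
    linarith
  obtain ⟨m, hm⟩ := exists_nat_ge (2 * G A / Real.pi)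
  have hm' : G A ≤ Real.pi * m / 2 := by
    rw [div_le_iff₀ Real.pi_pos] at hm
    linarith
  set B : ℝ := max A (2 * (Real.pi * m / 2 + Real.pi) / c) with hB
  have hAB : A ≤ B := le_max_left _ _
  have hGB : Real.pi * m / 2 ≤ G B := by
    have h1 : 2 * (Real.pi * m / 2 + Real.pi) / c ≤ B := le_max_right _ _
    rw [div_le_iff₀ hc] at h1
    linarith [G_lower B hAB]
  have hcont : ContinuousOn G (Set.Icc A B) := by
    have hqc : ContinuousOn q (Set.Icc A B) := by
      apply ContinuousOn.div continuousOn_id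
      · exact (continuous_const.mul Real.continuous_sinh).continuousOn
      · intro x hx
        exact (mul_pos hc (sinh_pos x hx.1)).ne'
    have ha : ContinuousOn (fun x => Real.arccos (q x)) (Set.Icc A B) :=
      Real.continuous_arccos.comp_continuousOn hqc
    exact ((continuous_const.mul Real.continuous_cosh).continuousOn.mul
      (Real.continuous_sin.comp_continuousOn ha)).sub ha
  obtain ⟨x, hx, hxG⟩ := intermediate_value_Icc hAB hcont ⟨hm', hGB⟩
  have hp := q_pos x hx.1
  have hl := q_le x hx.1
  refine ⟨x, Real.arccos (q x), m, (le_max_left _ _).trans hx.1, hA0.trans_le hx.1,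
    Real.arccos_pos.2 (by linarith), Real.arccos_lt_pi_div_two.2 hp, ?_, ?_⟩
  · rw [Real.cos_arccos (by linarith) (by linarith)]
    exact mul_div_cancel₀ x (mul_pos hc (sinh_pos x hx.1)).ne'
  · simp only [hG] at hxG
    linarith

/-- A solution `z = x + iy` of `(kd/2) sinh z = z + iπm/2` with `cos y > 0` gives the resonance
`-(k cosh z)²` of the square well of depth `k²` and width `d`. -/
lemma resonance_of_sinh_eq_add (k d x y : ℝ) (m : ℤ) (hk : 0 < k) (hy : 0 < Real.cos y)
    (hre : k * d / 2 * Real.sinh x * Real.cos y = x)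
    (him : k * d / 2 * Real.cosh x * Real.sin y = y + Real.pi * m / 2) :
    ∃ lam : ℂ, lam.im = -(2 * k ^ 2 * Real.sinh x * Real.cosh x * Real.cos y * Real.sin y) ∧
      k ^ 2 * Real.sinh x ^ 2 ≤ ‖lam‖ ∧
      ∃ s t : ℂ, s ^ 2 = ((-k ^ 2 : ℝ) : ℂ) - lam ∧ t ^ 2 = -lam ∧ t.re < 0 ∧
        Complex.exp (2 * s * d) = (s - t) ^ 4 / ((-k ^ 2 : ℝ) : ℂ) ^ 2 := by
  have hk' : (k : ℂ) ≠ 0 := by exact_mod_cast hk.ne'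
  set z : ℂ := x + y * Complex.I with hz
  have hcosh : Complex.cosh z = ((Real.cosh x * Real.cos y : ℝ) : ℂ)
      + ((Real.sinh x * Real.sin y : ℝ) : ℂ) * Complex.I := by
    rw [hz, Complex.cosh_add, Complex.cosh_mul_I, Complex.sinh_mul_I]
    push_cast
    ring
  have hsinh : Complex.sinh z = ((Real.sinh x * Real.cos y : ℝ) : ℂ)
      + ((Real.cosh x * Real.sin y : ℝ) : ℂ) * Complex.I := by
    rw [hz, Complex.sinh_add, Complex.cosh_mul_I, Complex.sinh_mul_I]
    push_cast
    ring
  have hcre : (Complex.cosh z).re = Real.cosh x * Real.cos y := by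
    rw [hcosh]
    simp only [Complex.add_re, Complex.ofReal_re, Complex.re_ofReal_mul, Complex.I_re, mul_zero,
      add_zero]
  have hcim : (Complex.cosh z).im = Real.sinh x * Real.sin y := by
    rw [hcosh]
    simp only [Complex.add_im, Complex.ofReal_im, Complex.im_ofReal_mul, Complex.I_im, mul_one,
      zero_add]
  refine ⟨-(k * Complex.cosh z) ^ 2, ?_, ?_, k * Complex.sinh z, -(k * Complex.cosh z),
    ?_, by ring, ?_, ?_⟩
  · simp only [pow_two, Complex.neg_im, Complex.mul_im, Complex.mul_re, Complex.ofReal_re,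
      Complex.ofReal_im, hcre, hcim]
    ring
  · rw [norm_neg, norm_pow, norm_mul, mul_pow, Complex.norm_real, Real.norm_eq_abs, sq_abs,
      ← Complex.normSq_eq_norm_sq, Complex.normSq_apply, hcre, hcim]
    gcongr
    have h1 := Real.cosh_sq x
    have h2 := Real.sin_sq_add_cos_sq y
    have h3 : Real.cosh x * Real.cos y * (Real.cosh x * Real.cos y) +
        Real.sinh x * Real.sin y * (Real.sinh x * Real.sin y) =
        Real.sinh x ^ 2 + Real.cos y ^ 2 := by
      linear_combination Real.cos y ^ 2 * h1 + Real.sinh x ^ 2 * h2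
    rw [h3]
    exact le_add_of_nonneg_right (sq_nonneg _)
  · push_cast
    linear_combination (-(k : ℂ) ^ 2) * Complex.cosh_sq z
  · rw [Complex.neg_re, Complex.re_ofReal_mul, hcre]
    have := Real.cosh_pos x
    exact neg_neg_of_pos (by positivity)
  · have hre' : (k : ℂ) * d / 2 * Real.sinh x * Real.cos y = x := by exact_mod_cast hre
    have him' : (k : ℂ) * d / 2 * Real.cosh x * Real.sin y = y + Real.pi * m / 2 := by
      exact_mod_cast congrArg ((↑) : ℝ → ℂ) him
    have h1 : 2 * (k * Complex.sinh z) * d = 4 * z + m * (2 * Real.pi * Complex.I) := by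
      rw [hsinh, hz]
      push_cast at hre' him' ⊢
      linear_combination 4 * hre' + 4 * Complex.I * him'
    have h2 : k * Complex.sinh z - -(k * Complex.cosh z) = k * Complex.exp z := by
      rw [← Complex.cosh_add_sinh z]
      ring
    have h3 : Complex.exp (4 * z) = Complex.exp z ^ 4 := by
      rw [← Complex.exp_nat_mul]
      norm_num
    rw [h1, Complex.exp_add, Complex.exp_int_mul_two_pi_mul_I, h2, h3]
    push_cast
    field_simp

lemma Set.infinite_of_forall_exists_norm_gt {E : Type*} [SeminormedAddCommGroup E] {S : Set E}
    (hS : ∀ R : ℝ, ∃ x ∈ S, R < ‖x‖) : S.Infinite := by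
  intro hfin
  obtain ⟨R, hR⟩ := hfin.isBounded.exists_norm_le
  obtain ⟨x, hx, hlt⟩ := hS R
  exact (hR x hx).not_gt hlt

/-- For `h < 0` and `a₁ < a₂`, the set of `λ` in the open upper half
plane admitting `s, t ∈ ℂ` with `s² = h - λ`, `t² = -λ`, `Re t < 0` and
`e^{2s(a₂-a₁)} = (s-t)⁴/h²` is infinite, and likewise for the open lower half plane. -/
theorem statement17 (h : ℝ) (hh : h < 0) (a₁ a₂ : ℝ) (ha : a₁ < a₂) :
    Set.Infinite {lam : ℂ | 0 < lam.im ∧ ∃ s t : ℂ, s ^ 2 = (h : ℂ) - lam ∧ t ^ 2 = -lam ∧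
        t.re < 0 ∧ Complex.exp (2 * s * ((a₂ : ℂ) - (a₁ : ℂ))) = (s - t) ^ 4 / (h : ℂ) ^ 2} ∧
    Set.Infinite {lam : ℂ | lam.im < 0 ∧ ∃ s t : ℂ, s ^ 2 = (h : ℂ) - lam ∧ t ^ 2 = -lam ∧
        t.re < 0 ∧ Complex.exp (2 * s * ((a₂ : ℂ) - (a₁ : ℂ))) = (s - t) ^ 4 / (h : ℂ) ^ 2} := by
  obtain ⟨k, hk, rfl⟩ : ∃ k : ℝ, 0 < k ∧ h = -k ^ 2 :=
    ⟨√(-h), Real.sqrt_pos.2 (by linarith), by rw [Real.sq_sqrt (by linarith)]; ring⟩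
  have hd : 0 < a₂ - a₁ := sub_pos.2 ha
  have key : ∀ R : ℝ, ∃ (x y : ℝ) (m : ℕ), 0 < Real.sinh x ∧ 0 < Real.cos y ∧ 0 < Real.sin y ∧
      R < k ^ 2 * Real.sinh x ^ 2 ∧ k * (a₂ - a₁) / 2 * Real.sinh x * Real.cos y = x ∧
      k * (a₂ - a₁) / 2 * Real.cosh x * Real.sin y = y + Real.pi * m / 2 := by
    intro R
    obtain ⟨x, y, m, hX, hx, hy, hy', hre, him⟩ :=
      exists_sinh_eq_add (k * (a₂ - a₁) / 2) (|R| / k ^ 2 + 1) (by positivity)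
    have hxs : x ≤ Real.sinh x := Real.self_le_sinh_iff.2 hx.le
    refine ⟨x, y, m, Real.sinh_pos_iff.2 hx, Real.cos_pos_of_mem_Ioo ⟨by linarith, hy'⟩,
      Real.sin_pos_of_pos_of_lt_pi hy (by linarith [Real.pi_pos]), ?_, hre, him⟩
    have h0 : 0 ≤ |R| / k ^ 2 := by positivity
    have h1 : |R| / k ^ 2 < Real.sinh x ^ 2 := by nlinarith
    rw [div_lt_iff₀ (by positivity)] at h1
    linarith [le_abs_self R]
  constructor <;> refine Set.infinite_of_forall_exists_norm_gt fun R => ?_ <;>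
    obtain ⟨x, y, m, hx, hc, hs, hR, hre, him⟩ := key R <;>
    have hch := Real.cosh_pos x
  · obtain ⟨lam, hlam, hn, s, t, h1, h2, h3, h4⟩ :=
      resonance_of_sinh_eq_add k (a₂ - a₁) x (-y) (-m) hk (by rwa [Real.cos_neg])
        (by rwa [Real.cos_neg]) (by rw [Real.sin_neg]; push_cast; linarith)
    refine ⟨lam, ⟨?_, s, t, h1, h2, h3, by simpa only [Complex.ofReal_sub] using h4⟩,
      hR.trans_le hn⟩
    rw [hlam, Real.cos_neg, Real.sin_neg, mul_neg, neg_neg]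
    positivity
  · obtain ⟨lam, hlam, hn, s, t, h1, h2, h3, h4⟩ :=
      resonance_of_sinh_eq_add k (a₂ - a₁) x y m hk hc hre (by exact_mod_cast him)
    refine ⟨lam, ⟨?_, s, t, h1, h2, h3, by simpa only [Complex.ofReal_sub] using h4⟩,
      hR.trans_le hn⟩
    rw [hlam]
    exact neg_neg_of_pos (by positivity)
end
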